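/- Let n, m ∈ ℕ with (n : ℝ) − m + 1 ≠ 0, N = n + m, and let p : Fin N → ZMod 2 be a parity function with n even and m odd indices; write σ(i) = (−1)^{p(i)}, ε(i,j) = (−1)^{p(i)p(j)}. For a supersymmetric array Γ : Fin N × Fin N × Fin N → ℝ (Γ(i,j,k) = ε(i,j)Γ(j,i,k)) define its traceless part Π(Γ)(i,j,k) := Γ(i,j,k) − (1/((n:ℝ)−m+1))·( div(Γ)(i)·δ(j,k) + ε(i,j)·div(Γ)(j)·δ(i,k) ), where div(Γ)(i) = ∑_s σ(s)Γ(i,s,s). Then for supersymmetric arrays Γ, Γ̄ one has Π(Γ) = Π(Γ̄) if and only if there exists ψ : Fin N → ℝ with Γ̄(i,j,k) = Γ(i,j,k) + ψ(i)δ(j,k) + ε(i,j)ψ(j)δ(i,k) for all i,j,k. -/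

import Mathlib

/-- The real sign `σ(i) = (−1)^{p(i)}` attached to a parity function `p`. -/
noncomputable def sgn {N : ℕ} (p : Fin N → ZMod 2) (i : Fin N) : ℝ :=
  (-1 : ℝ) ^ (p i).val

/-- The real sign `ε(i,j) = (−1)^{p(i)p(j)}`. -/
noncomputable def eps {N : ℕ} (p : Fin N → ZMod 2) (i j : Fin N) : ℝ :=
  (-1 : ℝ) ^ ((p i).val * (p j).val)

/-- Kronecker delta. -/
noncomputable def kdelta {N : ℕ} (i j : Fin N) : ℝ := if i = j then 1 else 0

/-- The supertrace-divergence `div(Γ)(i) = ∑ₛ σ(s)·Γ(i,s,s)`. -/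
noncomputable def sdiv {N : ℕ} (p : Fin N → ZMod 2)
    (A : Fin N → Fin N → Fin N → ℝ) (i : Fin N) : ℝ :=
  ∑ s, sgn p s * A i s s

/-- An array is supersymmetric in its two lower indices if
`Γ(i,j,k) = ε(i,j)·Γ(j,i,k)`. -/
def SuperSym {N : ℕ} (p : Fin N → ZMod 2) (A : Fin N → Fin N → Fin N → ℝ) : Prop :=
  ∀ i j k, A i j k = eps p i j * A j i k

/-- The traceless (projective) part of connection coefficients:
`Π(Γ)(i,j,k) = Γ(i,j,k) − (1/(n−m+1))·(div(Γ)(i)δ(j,k) + ε(i,j)div(Γ)(j)δ(i,k))`,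
where `c = (n:ℝ) − m + 1`. -/
noncomputable def projPart {N : ℕ} (c : ℝ) (p : Fin N → ZMod 2)
    (Γ : Fin N → Fin N → Fin N → ℝ) (i j k : Fin N) : ℝ :=
  Γ i j k - (1 / c) * (sdiv p Γ i * kdelta j k + eps p i j * sdiv p Γ j * kdelta i k)

theorem sgn_mul_eps_self {N : ℕ} (p : Fin N → ZMod 2) (i : Fin N) :
    sgn p i * eps p i i = 1 := by
  rw [sgn, eps, ← pow_add]
  exact (Nat.even_add.mpr (by simp [Nat.even_mul])).neg_one_pow

/-- The superdimension `n - m` is the sum of the signs of all indices. -/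
theorem sum_sgn {N n m : ℕ} (p : Fin N → ZMod 2)
    (hp0 : (Finset.univ.filter fun i => p i = 0).card = n)
    (hp1 : (Finset.univ.filter fun i => p i = 1).card = m) :
    ∑ i, sgn p i = (n : ℝ) - m := by
  have h : ∀ i, sgn p i = (if p i = 0 then 1 else 0) - (if p i = 1 then 1 else 0) := by
    intro i
    obtain ha | ha : p i = 0 ∨ p i = 1 := by
      generalize p i = a
      revert a
      decide
    · simp [sgn, ha]
    · simp [sgn, ha, ZMod.val_one]
  simp only [h, Finset.sum_sub_distrib, Finset.sum_boole, hp0, hp1]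

theorem sdiv_add_trace {N : ℕ} (p : Fin N → ZMod 2) (Γ Γ' : Fin N → Fin N → Fin N → ℝ)
    (ψ : Fin N → ℝ)
    (h : ∀ i j k, Γ' i j k = Γ i j k + ψ i * kdelta j k + eps p i j * ψ j * kdelta i k)
    (i : Fin N) :
    sdiv p Γ' i = sdiv p Γ i + (∑ s, sgn p s + 1) * ψ i := by
  have hs : ∑ s, sgn p s * (eps p i s * ψ s * kdelta i s) = ψ i := by
    rw [Finset.sum_eq_single i (fun s _ hs => by simp [kdelta, hs.symm]) (by simp)]
    rw [kdelta, if_pos rfl, mul_one, ← mul_assoc, sgn_mul_eps_self, one_mul]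
  have hd : ∀ s : Fin N, kdelta s s = 1 := fun s => if_pos rfl
  simp only [sdiv, h, mul_add, Finset.sum_add_distrib, hs, hd, mul_one, ← Finset.sum_mul]
  ring

/-- Two supersymmetric arrays of connection coefficients have the
same traceless (projective) part iff they differ by `j(ψ)` for some `ψ`. -/
theorem same_projective_class_iff {n m : ℕ}
    (hnm : (n : ℝ) - (m : ℝ) + 1 ≠ 0)
    (p : Fin (n + m) → ZMod 2)
    (hp0 : (Finset.univ.filter fun i => p i = 0).card = n)
    (hp1 : (Finset.univ.filter fun i => p i = 1).card = m)
    (Γ Γ' : Fin (n + m) → Fin (n + m) → Fin (n + m) → ℝ)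
    (hΓ : SuperSym p Γ) (hΓ' : SuperSym p Γ') :
    (∀ i j k, projPart ((n : ℝ) - (m : ℝ) + 1) p Γ i j k =
        projPart ((n : ℝ) - (m : ℝ) + 1) p Γ' i j k) ↔
      ∃ ψ : Fin (n + m) → ℝ,
        ∀ i j k, Γ' i j k =
          Γ i j k + ψ i * kdelta j k + eps p i j * ψ j * kdelta i k := by
  constructor
  · intro h
    refine ⟨fun i => (1 / ((n : ℝ) - m + 1)) * (sdiv p Γ' i - sdiv p Γ i), fun i j k => ?_⟩
    have := h i j k
    simp only [projPart] at this
    linear_combination -this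
  · rintro ⟨ψ, h⟩ i j k
    have hd := sdiv_add_trace p Γ Γ' ψ h
    rw [sum_sgn p hp0 hp1] at hd
    simp only [projPart, hd, h]
    field_simp
    ring
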